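/- Let V = GF(2)^3 ⊗ GF(2)^2, let e_0, e_1, e_2 be the standard basis of GF(2)^3 and u_1, u_2 the standard basis of GF(2)^2, let α ∈ GL_3(2) be any element of order 7, and let G_0 = {α^i ⊗ h : i ∈ Z, h ∈ GL_2(2)} ≤ GL(V). Set π = span{ e_0 ⊗ u_1, e_1 ⊗ u_1 + e_2 ⊗ u_2 }, a 2-dimensional GF(2)-subspace of V, and G = T ⋊ G_0 where T is the translation group of V. Then the incidence structure with point set V and block set the G-orbit of π is a 2-(64,4,2) design, and G acts flag-transitively on it. -/

import Mathlib

open TensorProduct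

/-- `V = GF(2)³ ⊗ GF(2)²`. -/
abbrev V13 := TensorProduct (ZMod 2) (Fin 3 → ZMod 2) (Fin 2 → ZMod 2)

/-- The 2-dimensional subspace `π = ⟨e₀⊗u₁, e₁⊗u₁ + e₂⊗u₂⟩` of `V13`. -/
noncomputable def pi13 : Submodule (ZMod 2) V13 :=
  Submodule.span (ZMod 2)
    {(Pi.single 0 1 : Fin 3 → ZMod 2) ⊗ₜ[ZMod 2] (Pi.single 0 1 : Fin 2 → ZMod 2),
     (Pi.single 1 1 : Fin 3 → ZMod 2) ⊗ₜ[ZMod 2] (Pi.single 0 1 : Fin 2 → ZMod 2) +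
       (Pi.single 2 1 : Fin 3 → ZMod 2) ⊗ₜ[ZMod 2] (Pi.single 1 1 : Fin 2 → ZMod 2)}

/-- The block set: the orbit of `pi13` under `G = T ⋊ G₀` with
`G₀ = {αⁱ ⊗ h : h ∈ GL₂(2)}`. -/
def blocks13 (α : (Fin 3 → ZMod 2) ≃ₗ[ZMod 2] (Fin 3 → ZMod 2)) : Set (Set V13) :=
  {C | ∃ (i : ℕ) (h : (Fin 2 → ZMod 2) ≃ₗ[ZMod 2] (Fin 2 → ZMod 2)) (v : V13),
    C = (fun x => (TensorProduct.congr (α ^ i) h) x + v) '' (pi13 : Set V13)}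

abbrev W3 := Fin 3 → ZMod 2
abbrev U2 := Fin 2 → ZMod 2

theorem W3.fix {α : W3 ≃ₗ[ZMod 2] W3} (h7 : α ^ 7 = 1) (h1 : α ≠ 1) {v : W3} (hv : v ≠ 0) :
    α v ≠ v := by
  classical
  intro hf
  have : Fact (Nat.Prime 7) := ⟨by norm_num⟩
  have h := Equiv.Perm.card_fixedPoints_modEq (f := (α.toEquiv : W3 → W3)) (p := 7) (n := 1) (by
    funext x
    exact congrArg (fun e : W3 ≃ₗ[ZMod 2] W3 => e x) h7)
  have hc : Fintype.card W3 = 8 := by simp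
  have hle := Fintype.card_subtype_le (fun x => x ∈ Function.fixedPoints (α.toEquiv : W3 → W3))
  have h2 : 1 < Fintype.card (Function.fixedPoints (α.toEquiv : W3 → W3)) := by
    rw [Fintype.one_lt_card_iff]
    refine ⟨⟨0, ?_⟩, ⟨v, hf⟩, ?_⟩
    · exact map_zero α
    · intro h; exact hv (congrArg Subtype.val h).symm
  have h8 : Fintype.card (Function.fixedPoints (α.toEquiv : W3 → W3)) = Fintype.card W3 := by
    rw [hc] at h ⊢
    change Fintype.card (Function.fixedPoints (α.toEquiv : W3 → W3)) ≤ _ at hle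
    rw [hc] at hle
    unfold Nat.ModEq at h
    omega
  apply h1
  ext1 x
  by_contra hx
  have := Fintype.card_subtype_lt (p := fun x => x ∈ Function.fixedPoints (α.toEquiv : W3 → W3)) (x := x) hx
  exact absurd h8 this.ne

theorem W3.fixpow {α : W3 ≃ₗ[ZMod 2] W3} (h7 : α ^ 7 = 1) (i : ℕ) {v : W3} (hv : v ≠ 0)
    (h : (α ^ i) v = v) : α ^ i = 1 := by
  by_contra h1
  exact W3.fix (by rw [← pow_mul, mul_comm, pow_mul, h7, one_pow]) h1 hv h

theorem W3.trans {α : W3 ≃ₗ[ZMod 2] W3} (h7 : orderOf α = 7) {v w : W3} (hv : v ≠ 0) (hw : w ≠ 0) :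
    ∃ i : ℕ, (α ^ i) v = w := by
  have h7' : α ^ 7 = 1 := h7 ▸ pow_orderOf_eq_one α
  have key : ∀ i j : ℕ, i ≤ j → j < 7 → (α ^ i) v = (α ^ j) v → i = j := by
    intro i j hij hj h
    have h1 : α ^ (j - i) = 1 := by
      apply W3.fixpow h7' _ hv
      apply (α ^ i).injective
      rw [h, ← LinearEquiv.mul_apply, ← pow_add]
      congr 2; omega
    have := orderOf_dvd_of_pow_eq_one h1
    rw [h7] at this
    have := Nat.eq_zero_of_dvd_of_lt this (by omega)
    omega
  let f : Fin 7 → {x : W3 // x ≠ 0} := fun i => ⟨(α ^ (i : ℕ)) v, by simpa using hv⟩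
  have hf : Function.Injective f := by
    intro i j h
    have h : (α ^ (i : ℕ)) v = (α ^ (j : ℕ)) v := congrArg Subtype.val h
    rcases le_total (i : ℕ) j with hl | hl
    · exact Fin.ext (key _ _ hl j.2 h)
    · exact Fin.ext (key _ _ hl i.2 h.symm).symm
  obtain ⟨i, hi⟩ := (hf.bijective_of_nat_card_le (by
    rw [Nat.card_eq_fintype_card, Nat.card_eq_fintype_card]; decide +kernel)).2 ⟨w, hw⟩
  exact ⟨i, congrArg Subtype.val hi⟩

noncomputable def cc (k : Fin 2) : V13 →ₗ[ZMod 2] W3 :=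
  TensorProduct.lift ((LinearMap.lsmul (ZMod 2) W3).flip.compl₂ (LinearMap.proj k))

@[simp] theorem cc_tmul (k : Fin 2) (w : W3) (u : U2) : cc k (w ⊗ₜ u) = u k • w := by
  simp [cc]

theorem cc_rep (d : V13) : d = cc 0 d ⊗ₜ[ZMod 2] (Pi.single 0 1 : U2) + cc 1 d ⊗ₜ[ZMod 2] (Pi.single 1 1 : U2) := by
  induction d using TensorProduct.induction_on with
  | zero => simp
  | add x y hx hy => 
    conv_lhs => rw [hx, hy]
    simp only [map_add, TensorProduct.add_tmul]; abel
  | tmul w u => 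
    simp only [cc_tmul, TensorProduct.smul_tmul, ← TensorProduct.tmul_add]
    congr 1
    ext k; fin_cases k <;> simp

theorem cardH : Nat.card (U2 ≃ₗ[ZMod 2] U2) = 6 := by
  have h := Matrix.card_GL_field (𝔽 := ZMod 2) 2
  rw [← Nat.card_congr (LinearMap.GeneralLinearGroup.generalLinearEquiv (ZMod 2) U2).toEquiv]
  rw [← Nat.card_congr (Matrix.GeneralLinearGroup.toLin (n := Fin 2) (R := ZMod 2)).toEquiv, h]
  simp [Fin.prod_univ_succ]

theorem cardV : Nat.card V13 = 64 := by
  rw [Module.natCard_eq_pow_finrank (K := ZMod 2)]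
  simp

theorem cardR : Nat.card {pq : W3 × W3 // pq.1 ≠ 0 ∧ pq.2 ≠ 0 ∧ pq.1 ≠ pq.2} = 42 := by
  rw [Nat.card_eq_fintype_card]
  decide +kernel

theorem exh (u : U2) (hu : u ≠ 0) : ∃ h : U2 ≃ₗ[ZMod 2] U2, h (Pi.single 0 1) = u := by
  have : ∃ M N : Matrix (Fin 2) (Fin 2) (ZMod 2), M * N = 1 ∧ N * M = 1 ∧ M.mulVec (Pi.single 0 1) = u := by
    revert u; decide +kernel
  obtain ⟨M, N, h1, h2, h3⟩ := this
  exact ⟨Matrix.toLin'OfInv h2 h1, h3⟩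

def tau : U2 ≃ₗ[ZMod 2] U2 :=
  Matrix.toLin'OfInv (M := !![1,1;0,1]) (M' := !![1,1;0,1]) (by decide) (by decide)

theorem tau0 : tau (Pi.single 0 1) = Pi.single 0 1 := by
  exact (show Matrix.mulVec (!![1,1;0,1] : Matrix (Fin 2) (Fin 2) (ZMod 2)) (Pi.single 0 1) =
    Pi.single 0 1 by decide +kernel)
theorem tau1 : tau (Pi.single 1 1) = Pi.single 0 1 + Pi.single 1 1 := by
  exact (show Matrix.mulVec (!![1,1;0,1] : Matrix (Fin 2) (Fin 2) (ZMod 2)) (Pi.single 1 1) =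
    Pi.single 0 1 + Pi.single 1 1 by decide +kernel)

noncomputable def aa : V13 := (Pi.single 0 1 : W3) ⊗ₜ[ZMod 2] (Pi.single 0 1 : U2)
noncomputable def bb : V13 := (Pi.single 1 1 : W3) ⊗ₜ[ZMod 2] (Pi.single 0 1 : U2) +
       (Pi.single 2 1 : W3) ⊗ₜ[ZMod 2] (Pi.single 1 1 : U2)

theorem cc_ext {x y : V13} (h0 : cc 0 x = cc 0 y) (h1 : cc 1 x = cc 1 y) : x = y := by
  rw [cc_rep x, cc_rep y, h0, h1]

theorem caa0 : cc 0 aa = Pi.single 0 1 := by simp [aa]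
theorem caa1 : cc 1 aa = 0 := by simp [aa]
theorem cbb0 : cc 0 bb = Pi.single 1 1 := by simp [bb]
theorem cbb1 : cc 1 bb = Pi.single 2 1 := by simp [bb]

theorem mem_pi (x : V13) : x ∈ pi13 ↔ x = 0 ∨ x = aa ∨ x = bb ∨ x = aa + bb := by
  unfold pi13
  rw [Submodule.mem_span_pair]
  change (∃ c d : ZMod 2, c • aa + d • bb = x) ↔ _
  constructor
  · rintro ⟨c, d, rfl⟩
    have hz : ∀ c : ZMod 2, c = 0 ∨ c = 1 := by decide
    rcases hz c with rfl | rfl <;> rcases hz d with rfl | rfl <;> simp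
  · rintro (rfl | rfl | rfl | rfl)
    · exact ⟨0, 0, by simp⟩
    · exact ⟨1, 0, by simp⟩
    · exact ⟨0, 1, by simp⟩
    · exact ⟨1, 1, by simp⟩

theorem aa_ne : aa ≠ 0 := fun h => by
  have := congrArg (cc 0) h
  rw [caa0, map_zero] at this; revert this; decide
theorem bb_ne : bb ≠ 0 := fun h => by
  have := congrArg (cc 0) h
  rw [cbb0, map_zero] at this; revert this; decide
theorem aa_ne_bb : aa ≠ bb := fun h => by
  have := congrArg (cc 0) h
  rw [cbb0, caa0] at this; revert this; decide

theorem aa_add : aa + aa = 0 := by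
  rw [← two_smul (ZMod 2) aa]
  have : (2 : ZMod 2) = 0 := by decide
  rw [this, zero_smul]

theorem card_pi : (pi13 : Set V13).ncard = 4 := by
  have : (pi13 : Set V13) = {0, aa, bb, aa + bb} := by
    ext x; simp [mem_pi]
  rw [this]
  have h1 := aa_ne
  have h2 := bb_ne
  have h3 := aa_ne_bb
  have h4 : aa + bb ≠ 0 := fun h => h3 (by
    have : aa + aa = aa + bb := by rw [h, aa_add]
    exact add_left_cancel this)
  rw [Set.ncard_insert_of_notMem, Set.ncard_insert_of_notMem, Set.ncard_pair]
  · simpa using h1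
  · simp [h2, h3]
  · simp [h1.symm, h2.symm, h4.symm]

/-- The group `G₀`. -/
def G0 (α : W3 ≃ₗ[ZMod 2] W3) (hα : orderOf α = 7) : Subgroup (V13 ≃ₗ[ZMod 2] V13) where
  carrier := {g | ∃ (i : ℕ) (h : U2 ≃ₗ[ZMod 2] U2), g = TensorProduct.congr (α ^ i) h}
  one_mem' := ⟨0, 1, by
    rw [pow_zero]; exact TensorProduct.congr_refl_refl.symm⟩
  mul_mem' := by
    rintro _ _ ⟨i, h, rfl⟩ ⟨j, k, rfl⟩
    exact ⟨i + j, h * k, by rw [pow_add, TensorProduct.congr_mul]⟩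
  inv_mem' := by
    rintro _ ⟨i, h, rfl⟩
    refine ⟨6 * i, h⁻¹, ?_⟩
    rw [inv_eq_iff_mul_eq_one, ← TensorProduct.congr_mul, ← pow_add]
    have : α ^ (i + 6 * i) = 1 := by
      rw [show i + 6 * i = 7 * i by ring, pow_mul, ← hα, pow_orderOf_eq_one, one_pow]
    rw [this, mul_inv_cancel]
    exact TensorProduct.congr_refl_refl

section
variable {α : W3 ≃ₗ[ZMod 2] W3} {hα : orderOf α = 7}

theorem zsmul_eq13 {c : ZMod 2} {w v : W3} (hv : v ≠ 0) (h : c • w = v) : c = 1 ∧ w = v := by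
  have hz : ∀ c : ZMod 2, c = 0 ∨ c = 1 := by decide
  rcases hz c with rfl | rfl
  · simp at h; exact absurd h.symm hv
  · simpa using h

theorem u2_ext {u v : U2} (h0 : u 0 = v 0) (h1 : u 1 = v 1) : u = v := by
  ext k; fin_cases k
  · exact h0
  · exact h1

theorem u2_equiv_ext {h k : U2 ≃ₗ[ZMod 2] U2} (h0 : h (Pi.single 0 1) = k (Pi.single 0 1))
    (h1 : h (Pi.single 1 1) = k (Pi.single 1 1)) : h = k := by
  ext u : 1
  have : u = u 0 • Pi.single 0 1 + u 1 • Pi.single 1 1 := by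
    apply u2_ext <;> simp
  rw [this, map_add, map_add, map_smul, map_smul, map_smul, map_smul, h0, h1]

theorem congr_one_one : TensorProduct.congr (1 : W3 ≃ₗ[ZMod 2] W3) (1 : U2 ≃ₗ[ZMod 2] U2) = 1 :=
  TensorProduct.congr_refl_refl

noncomputable def tt : V13 ≃ₗ[ZMod 2] V13 := TensorProduct.congr 1 tau

theorem tt_mem : tt ∈ G0 α hα := ⟨0, tau, by rw [pow_zero]; rfl⟩

theorem tt_aa : tt aa = aa := by
  simp [tt, aa, TensorProduct.congr_tmul, tau0]

theorem stab_aa {g} (hg : g ∈ G0 α hα) (h : g aa = aa) : g = 1 ∨ g = tt := by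
  obtain ⟨i, k, rfl⟩ := hg
  have h0 := congrArg (cc 0) h
  have h1 := congrArg (cc 1) h
  rw [caa0, aa, TensorProduct.congr_tmul, cc_tmul] at h0
  rw [caa1, aa, TensorProduct.congr_tmul, cc_tmul] at h1
  obtain ⟨hc, hw⟩ := zsmul_eq13 (by decide) h0
  have hi := W3.fixpow (hα ▸ pow_orderOf_eq_one α) i (by decide) hw
  rw [hw] at h1
  have hc1 : k (Pi.single 0 1) 1 = 0 := by simpa using h1
  have hk : k (Pi.single 0 1) = Pi.single 0 1 := u2_ext (by rw [hc]; rfl) (by rw [hc1]; rfl)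
  have hne0 : k (Pi.single 1 1) ≠ 0 := by simp
  have hne1 : k (Pi.single 1 1) ≠ Pi.single 0 1 := by
    intro h
    rw [← hk] at h
    exact absurd (k.injective h) (by decide)
  have hu : ∀ u : U2, u ≠ 0 → u ≠ Pi.single 0 1 →
    u = Pi.single 1 1 ∨ u = Pi.single 0 1 + Pi.single 1 1 := by decide
  rw [hi]
  rcases hu _ hne0 hne1 with hu | hu
  · left
    rw [← congr_one_one]
    congr 1
    exact u2_equiv_ext hk hu
  · right
    rw [tt]
    congr 1
    exact u2_equiv_ext (hk.trans tau0.symm) (hu.trans tau1.symm)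

theorem aa_not_bb {g} (hg : g ∈ G0 α hα) : g aa ≠ bb := by
  obtain ⟨i, k, rfl⟩ := hg
  intro h
  have h0 := congrArg (cc 0) h
  have h1 := congrArg (cc 1) h
  rw [cbb0, aa, TensorProduct.congr_tmul, cc_tmul] at h0
  rw [cbb1, aa, TensorProduct.congr_tmul, cc_tmul] at h1
  have := (zsmul_eq13 (by decide) h0).2.symm.trans (zsmul_eq13 (by decide) h1).2
  revert this; decide

theorem aa_not_ab {g} (hg : g ∈ G0 α hα) : g aa ≠ aa + bb := by
  obtain ⟨i, k, rfl⟩ := hg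
  intro h
  have h0 := congrArg (cc 0) h
  have h1 := congrArg (cc 1) h
  rw [map_add, cbb0, caa0, aa, TensorProduct.congr_tmul, cc_tmul] at h0
  rw [map_add, cbb1, caa1, aa, TensorProduct.congr_tmul, cc_tmul] at h1
  have := (zsmul_eq13 (by decide) h0).2.symm.trans (zsmul_eq13 (by decide) h1).2
  revert this; decide

theorem stab_bb' {i : ℕ} {k : U2 ≃ₗ[ZMod 2] U2} (hα : orderOf α = 7)
    (h : TensorProduct.congr (α ^ i) k bb = bb) : α ^ i = 1 ∧ k = 1 := by
  have h7 : α ^ 7 = 1 := hα ▸ pow_orderOf_eq_one α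
  have hi : α ^ i = 1 := by
    have h' : TensorProduct.congr (α ^ i) 1 bb = TensorProduct.congr 1 k⁻¹ bb := by
      conv_rhs => rw [← h]
      rw [← LinearEquiv.mul_apply, ← TensorProduct.congr_mul]
      simp
    have h0 := congrArg (fun x => cc 0 x 0) h'
    have h1 := congrArg (fun x => cc 1 x 0) h'
    simp [bb, TensorProduct.congr_tmul] at h0 h1
    have hP : ∀ x : W3, x 0 = 0 → (α ^ i) x 0 = 0 := by
      intro x hx
      have : x = x 1 • Pi.single 1 1 + x 2 • Pi.single 2 1 := by
        ext j; fin_cases j <;> simp [hx]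
      rw [this, map_add, map_smul, map_smul]
      simp [h0, h1]
    have hn : ∀ n : ℕ, ((α ^ i) ^ n) (Pi.single 1 1) 0 = 0 := by
      intro n
      induction n with
      | zero => simp
      | succ n ih => rw [pow_succ', LinearEquiv.mul_apply]; exact hP _ ih
    by_contra hne
    have ho : orderOf (α ^ i) = 7 := by
      have : Fact (Nat.Prime 7) := ⟨by norm_num⟩
      exact orderOf_eq_prime (by rw [← pow_mul, mul_comm, pow_mul, h7, one_pow]) hne
    obtain ⟨n, hn'⟩ := W3.trans ho (v := Pi.single 1 1) (w := Pi.single 0 1) (by decide) (by decide)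
    have := hn n
    rw [hn'] at this
    simp at this
  refine ⟨hi, ?_⟩
  rw [hi] at h
  have h0 := congrArg (cc 0) h
  have h1 := congrArg (cc 1) h
  rw [cbb0] at h0
  rw [cbb1] at h1
  simp only [bb, map_add, TensorProduct.congr_tmul, cc_tmul, LinearEquiv.coe_one, id] at h0 h1
  have e01 := congrFun h0 1
  have e02 := congrFun h0 2
  have e11 := congrFun h1 1
  have e12 := congrFun h1 2
  simp at e01 e02 e11 e12
  exact u2_equiv_ext (u2_ext (by simpa using e01) (by simpa using e11))
    (u2_ext (by simpa using e02) (by simpa using e12))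

theorem stab_bb {g} (hg : g ∈ G0 α hα) (h : g bb = bb) : g = 1 := by
  obtain ⟨i, k, rfl⟩ := hg
  obtain ⟨h1, h2⟩ := stab_bb' hα h
  rw [h1, h2, congr_one_one]

theorem orb_aa (w : W3) (u : U2) (hw : w ≠ 0) (hu : u ≠ 0) : ∃ g ∈ G0 α hα, g aa = w ⊗ₜ u := by
  obtain ⟨i, hi⟩ := W3.trans hα (v := Pi.single 0 1) (by decide) hw
  obtain ⟨h, hh⟩ := exh u hu
  exact ⟨_, ⟨i, h, rfl⟩, by rw [aa, TensorProduct.congr_tmul, hi, hh]⟩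

theorem orb_aa' (d : V13) (hd : d ≠ 0) (hn : ¬ ∃ g ∈ G0 α hα, g aa = d) :
    cc 0 d ≠ 0 ∧ cc 1 d ≠ 0 ∧ cc 0 d ≠ cc 1 d := by
  refine ⟨fun h => hn ?_, fun h => hn ?_, fun h => hn ?_⟩
  · have h1 : cc 1 d ≠ 0 := fun h1 => hd (cc_ext (by simp [h]) (by simp [h1]))
    rw [cc_rep d, h, TensorProduct.zero_tmul, zero_add]
    exact orb_aa _ _ h1 (by decide)
  · have h1 : cc 0 d ≠ 0 := fun h1 => hd (cc_ext (by simp [h1]) (by simp [h]))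
    rw [cc_rep d, h, TensorProduct.zero_tmul, add_zero]
    exact orb_aa _ _ h1 (by decide)
  · have h1 : cc 1 d ≠ 0 := fun h1 => hd (cc_ext (by simp [h, h1]) (by simp [h1]))
    rw [cc_rep d, h, ← TensorProduct.tmul_add]
    exact orb_aa _ _ h1 (by decide)

theorem orb (d : V13) (hd : d ≠ 0) (hn : ¬ ∃ g ∈ G0 α hα, g aa = d) : ∃ g ∈ G0 α hα, g bb = d := by
  let R := {pq : W3 × W3 // pq.1 ≠ 0 ∧ pq.2 ≠ 0 ∧ pq.1 ≠ pq.2}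
  have hmem : ∀ (i : ℕ) (k : U2 ≃ₗ[ZMod 2] U2), TensorProduct.congr (α ^ i) k ∈ G0 α hα :=
    fun i k => ⟨i, k, rfl⟩
  let f : Fin 7 × (U2 ≃ₗ[ZMod 2] U2) → R := fun x =>
    ⟨(cc 0 (TensorProduct.congr (α ^ (x.1 : ℕ)) x.2 bb), cc 1 (TensorProduct.congr (α ^ (x.1 : ℕ)) x.2 bb)), by
      apply orb_aa' (α := α) (hα := hα)
      · simpa using bb_ne
      · rintro ⟨g, hg, h⟩
        apply aa_not_bb ((G0 α hα).mul_mem ((G0 α hα).inv_mem (hmem x.1 x.2)) hg)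
        rw [LinearEquiv.mul_apply, h, ← LinearEquiv.mul_apply, inv_mul_cancel]
        rfl⟩
  have hf : Function.Injective f := by
    rintro ⟨i, h⟩ ⟨j, k⟩ e
    have e' := congrArg Subtype.val e
    have e0 := cc_ext (congrArg Prod.fst e') (congrArg Prod.snd e')
    simp only at e0
    have h7 : α ^ 7 = 1 := hα ▸ pow_orderOf_eq_one α
    have hij : α ^ (7 - (j : ℕ)) * α ^ (j : ℕ) = 1 := by
      rw [← pow_add, Nat.sub_add_cancel j.2.le, h7]
    have e1 := congrArg (TensorProduct.congr (α ^ (7 - (j : ℕ))) k⁻¹) e0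
    rw [← LinearEquiv.mul_apply, ← LinearEquiv.mul_apply, ← TensorProduct.congr_mul,
      ← TensorProduct.congr_mul, inv_mul_cancel, hij, congr_one_one, ← pow_add] at e1
    obtain ⟨h1, h2⟩ := stab_bb' hα e1
    have h1 := orderOf_dvd_of_pow_eq_one h1
    rw [hα] at h1
    have hk : h = k := (inv_mul_eq_one.1 h2).symm
    have : i = j := by
      ext
      obtain ⟨i, hi⟩ := i
      obtain ⟨j, hj⟩ := j
      simp only at h1 ⊢
      omega
    rw [hk, this]
  have hb := hf.bijective_of_nat_card_le (by
    rw [cardR, Nat.card_prod, cardH]; simp)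
  obtain ⟨⟨i, k⟩, e⟩ := hb.2 ⟨(cc 0 d, cc 1 d), orb_aa' d hd hn⟩
  have e' := congrArg Subtype.val e
  exact ⟨_, hmem i k, cc_ext (congrArg Prod.fst e') (congrArg Prod.snd e')⟩

theorem tt_pi : tt bb ∉ pi13 := by
  have h0 : cc 0 (tt bb) = Pi.single 1 1 + Pi.single 2 1 := by
    simp [tt, bb, TensorProduct.congr_tmul, tau0, tau1]
  rw [mem_pi]
  rintro (h | h | h | h) <;> rw [h] at h0 <;>
    simp only [map_zero, map_add, caa0, cbb0] at h0 <;> revert h0 <;> decide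

theorem stab_pi {g} (hg : g ∈ G0 α hα) (h : ∀ x ∈ pi13, g x ∈ pi13) : g = 1 := by
  have ha : g aa = aa := by
    rcases (mem_pi _).1 (h aa ((mem_pi _).2 (by simp))) with h | h | h | h
    · exact absurd (by simpa using h) aa_ne
    · exact h
    · exact absurd h (aa_not_bb hg)
    · exact absurd h (aa_not_ab hg)
  rcases stab_aa hg ha with rfl | rfl
  · rfl
  · exact absurd (h bb ((mem_pi _).2 (by simp))) tt_pi

/-- Images of `π` under `G₀` containing `d`. -/
def SS (α : W3 ≃ₗ[ZMod 2] W3) (hα : orderOf α = 7) (d : V13) : Set (Set V13) :=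
  {C | d ∈ C ∧ ∃ g ∈ G0 α hα, C = g '' (pi13 : Set V13)}

theorem mem_image_iff {g : V13 ≃ₗ[ZMod 2] V13} {d : V13} :
    d ∈ g '' (pi13 : Set V13) ↔ g⁻¹ d ∈ pi13 := by
  constructor
  · rintro ⟨x, hx, rfl⟩
    rw [← LinearEquiv.mul_apply, inv_mul_cancel]; exact hx
  · intro h
    exact ⟨_, h, by rw [← LinearEquiv.mul_apply, mul_inv_cancel]; rfl⟩

theorem image_ne {g} (hg : g ∈ G0 α hα) (h1 : g ≠ 1) : (pi13 : Set V13) ≠ g '' (pi13 : Set V13) := by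
  intro h
  apply h1
  apply stab_pi hg
  intro x hx
  have : g x ∈ (pi13 : Set V13) := by rw [h]; exact ⟨x, hx, rfl⟩
  exact this

theorem image_one : ((1 : V13 ≃ₗ[ZMod 2] V13) '' (pi13 : Set V13)) = pi13 := by
  ext x; simp

theorem SS_aa : (SS α hα aa).ncard = 2 := by
  have : SS α hα aa = {(pi13 : Set V13), tt '' (pi13 : Set V13)} := by
    ext C
    simp only [SS, Set.mem_ofPred_eq, Set.mem_insert_iff, Set.mem_singleton_iff]
    constructor
    · rintro ⟨hd, g, hg, rfl⟩
      rw [mem_image_iff, mem_pi] at hd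
      have hg' := (G0 α hα).inv_mem hg
      rcases hd with h | h | h | h
      · exact absurd (by simpa using h) aa_ne
      · have : g aa = aa := by
          conv_lhs => rw [← h]
          rw [← LinearEquiv.mul_apply, mul_inv_cancel]; rfl
        rcases stab_aa hg this with rfl | rfl
        · left; exact image_one
        · right; rfl
      · exact absurd h (aa_not_bb hg')
      · exact absurd h (aa_not_ab hg')
    · rintro (rfl | rfl)
      · exact ⟨(mem_pi _).2 (by simp), 1, (G0 α hα).one_mem, image_one.symm⟩
      · exact ⟨⟨aa, (mem_pi _).2 (by simp), tt_aa⟩, tt, tt_mem, rfl⟩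
  rw [this, Set.ncard_pair]
  refine image_ne (α := α) (hα := hα) tt_mem ?_
  intro h
  apply tt_pi
  rw [h]
  exact (mem_pi _).2 (by simp)

theorem SS_bb : (SS α hα bb).ncard = 2 := by
  have hne : aa + bb ≠ 0 := fun h => aa_ne_bb (by
    have : aa + aa = aa + bb := by rw [h, aa_add]
    exact add_left_cancel this)
  obtain ⟨g0, hg0, h0⟩ := orb (α := α) (hα := hα) (aa + bb) hne (by
    rintro ⟨g, hg, h⟩; exact aa_not_ab hg h)
  have hi : g0⁻¹ (aa + bb) = bb := by
    rw [← h0, ← LinearEquiv.mul_apply, inv_mul_cancel]; rfl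
  have hg0' := (G0 α hα).inv_mem hg0
  have : SS α hα bb = {(pi13 : Set V13), (g0⁻¹ : V13 ≃ₗ[ZMod 2] V13) '' (pi13 : Set V13)} := by
    ext C
    simp only [SS, Set.mem_ofPred_eq, Set.mem_insert_iff, Set.mem_singleton_iff]
    constructor
    · rintro ⟨hd, g, hg, rfl⟩
      rw [mem_image_iff, mem_pi] at hd
      have hgg : ∀ x, g (g⁻¹ x) = x := fun x => by
        rw [← LinearEquiv.mul_apply, mul_inv_cancel]; rfl
      rcases hd with h | h | h | h
      · exact absurd (by simpa using h) bb_ne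
      · exact absurd (by rw [← h, hgg]) (aa_not_bb hg)
      · have : g bb = bb := by
          conv_lhs => rw [← h]
          exact hgg _
        rw [stab_bb hg this]
        left; exact image_one
      · have : (g * g0) bb = bb := by
          rw [LinearEquiv.mul_apply, h0, ← h]
          exact hgg _
        have := stab_bb ((G0 α hα).mul_mem hg hg0) this
        rw [eq_inv_of_mul_eq_one_left this]
        right; rfl
    · rintro (rfl | rfl)
      · exact ⟨(mem_pi _).2 (by simp), 1, (G0 α hα).one_mem, image_one.symm⟩
      · exact ⟨⟨aa + bb, (mem_pi _).2 (by simp), hi⟩, g0⁻¹, hg0', rfl⟩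
  rw [this, Set.ncard_pair]
  refine image_ne hg0' ?_
  intro h
  rw [h] at hi
  have : aa + bb = bb := hi
  exact aa_ne (by simpa using this)

theorem block_iff {C : Set V13} {x : V13} (hα : orderOf α = 7) :
    (C ∈ blocks13 α ∧ x ∈ C) ↔ ∃ g ∈ G0 α hα, C = (fun z => g z + x) '' (pi13 : Set V13) := by
  constructor
  · rintro ⟨⟨i, h, v, rfl⟩, ⟨p, hp, rfl⟩⟩
    refine ⟨_, ⟨i, h, rfl⟩, ?_⟩
    ext y
    constructor
    · rintro ⟨q, hq, rfl⟩
      exact ⟨q - p, pi13.sub_mem hq hp, by simp only [map_sub]; abel⟩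
    · rintro ⟨q, hq, rfl⟩
      exact ⟨q + p, pi13.add_mem hq hp, by simp [add_assoc]⟩
  · rintro ⟨_, ⟨i, h, rfl⟩, rfl⟩
    exact ⟨⟨i, h, x, rfl⟩, 0, pi13.zero_mem, by simp⟩

theorem pairs {x y : V13} (hα : orderOf α = 7) {g : V13 ≃ₗ[ZMod 2] V13} (hg : g ∈ G0 α hα) {d : V13}
    (hd : g d = y - x) :
    {C ∈ blocks13 α | x ∈ C ∧ y ∈ C}.ncard = (SS α hα d).ncard := by
  have hinj : Function.Injective (fun z => g z + x) := fun a b h => by simpa using h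
  rw [← Set.ncard_image_of_injective (SS α hα d) hinj.image_injective]
  congr 1
  ext C
  rw [Set.mem_ofPred_eq, ← and_assoc, block_iff hα]
  have hy : y = g d + x := by rw [hd]; abel
  constructor
  · rintro ⟨⟨k, hk, rfl⟩, hyC⟩
    refine ⟨(g⁻¹ * k : V13 ≃ₗ[ZMod 2] V13) '' pi13, ⟨?_, _, (G0 α hα).mul_mem ((G0 α hα).inv_mem hg) hk, rfl⟩, ?_⟩
    · obtain ⟨p, hp, e⟩ := hyC
      refine ⟨p, hp, ?_⟩
      have e : k p = g d := by rw [hy] at e; simpa using e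
      rw [LinearEquiv.mul_apply, e, ← LinearEquiv.mul_apply, inv_mul_cancel]; rfl
    · rw [Set.image_image]
      congr 1
      ext z
      rw [← LinearEquiv.mul_apply, mul_inv_cancel_left]
  · rintro ⟨_, ⟨hdC, k, hk, rfl⟩, rfl⟩
    refine ⟨⟨g * k, (G0 α hα).mul_mem hg hk, ?_⟩, ?_⟩
    · rw [Set.image_image]; rfl
    · exact ⟨d, hdC, hy.symm⟩

end

/-- Let `α ∈ GL₃(2)` of order 7 and `G₀ = {αⁱ ⊗ h : h ∈ GL₂(2)}` acting
on `V = GF(2)³ ⊗ GF(2)²`; let `π = ⟨e₀⊗u₁, e₁⊗u₁ + e₂⊗u₂⟩` and `G = T ⋊ G₀`.  Then the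
orbit of `π` under `G` is the block set of a 2-(64,4,2) design, and `G` acts
flag-transitively on it. -/
theorem stmt_13 (α : (Fin 3 → ZMod 2) ≃ₗ[ZMod 2] (Fin 3 → ZMod 2)) (hα : orderOf α = 7) :
    Nat.card V13 = 64 ∧
    (∀ C ∈ blocks13 α, C.ncard = 4) ∧
    (∀ x y : V13, x ≠ y → {C ∈ blocks13 α | x ∈ C ∧ y ∈ C}.ncard = 2) ∧
    (∀ C ∈ blocks13 α, ∀ C' ∈ blocks13 α, ∀ x ∈ C, ∀ y ∈ C',
      ∃ (i : ℕ) (h : (Fin 2 → ZMod 2) ≃ₗ[ZMod 2] (Fin 2 → ZMod 2)) (v : V13),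
        (fun z => (TensorProduct.congr (α ^ i) h) z + v) '' C = C' ∧
        (TensorProduct.congr (α ^ i) h) x + v = y) := by
  refine ⟨cardV, ?_, ?_, ?_⟩
  · rintro C ⟨i, h, v, rfl⟩
    rw [Set.ncard_image_of_injective, card_pi]
    intro a b h
    simpa using h
  · intro x y hxy
    have hd : y - x ≠ 0 := sub_ne_zero.2 hxy.symm
    by_cases hn : ∃ g ∈ G0 α hα, g aa = y - x
    · obtain ⟨g, hg, h⟩ := hn
      rw [pairs hα hg h, SS_aa]
    · obtain ⟨g, hg, h⟩ := orb _ hd hn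
      rw [pairs hα hg h, SS_bb]
  · intro C hC C' hC' x hx y hy
    obtain ⟨g, hg, rfl⟩ := (block_iff hα).1 ⟨hC, hx⟩
    obtain ⟨k, hk, rfl⟩ := (block_iff hα).1 ⟨hC', hy⟩
    obtain ⟨i, h, e⟩ := (G0 α hα).mul_mem hk ((G0 α hα).inv_mem hg)
    refine ⟨i, h, y - TensorProduct.congr (α ^ i) h x, ?_, by abel⟩
    rw [← e, Set.image_image]
    congr 1
    ext z
    rw [map_add, ← LinearEquiv.mul_apply, inv_mul_cancel_right]
    abel
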